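/- Let s ∈ M_m be maximal. Then ⌊log_q(m/8)⌋ < d_t(s) ≤ d_{t+1}(s) ≤ ⌊log_q m⌋ + 1; in particular m < 8·q^{d_t(s)} and q^{d_{t+1}(s) − 1} ≤ m. -/

import Mathlib

open Polynomial

/-- `Φ(s)`: the number of distinct monic divisors of `s` in `F[x]`. -/
noncomputable def numDiv {F : Type} [Field F] (s : F[X]) : ℕ :=
  Set.ncard {d : F[X] | d.Monic ∧ d ∣ s}

/-- `s` is maximal in `M_m`: `s` is monic of degree exactly `m` and `Φ(s) = Υ_m`. -/
def IsMaximal {F : Type} [Field F] (m : ℕ) (s : F[X]) : Prop :=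
  s.Monic ∧ s.natDegree = m ∧
    ∀ t : F[X], t.Monic → t.natDegree ≤ m → numDiv t ≤ numDiv s

/-- `d_t(s)`: the largest degree of a monic irreducible factor of `s`. -/
noncomputable def dt {F : Type} [Field F] (s : F[X]) : ℕ :=
  sSup {d : ℕ | ∃ p : F[X], p.Monic ∧ Irreducible p ∧ p ∣ s ∧ p.natDegree = d}

/-- `d_{t+1}(s)`: the smallest positive integer `d` such that some monic irreducible
polynomial of degree `d` does not divide `s`. -/
noncomputable def dt1 {F : Type} [Field F] (s : F[X]) : ℕ :=
  sInf {d : ℕ | 0 < d ∧ ∃ p : F[X], p.Monic ∧ Irreducible p ∧ p.natDegree = d ∧ ¬ p ∣ s}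

open UniqueFactorizationMonoid

section Field

variable {F : Type} [Field F]

lemma finite_monic_divisors [Finite F] {s : F[X]} (hs : s ≠ 0) :
    {d : F[X] | d.Monic ∧ d ∣ s}.Finite := by
  have : Finite (degreeLT F (s.natDegree + 1)) :=
    .of_equiv _ (degreeLTEquiv F (s.natDegree + 1)).symm.toEquiv
  refine (Set.toFinite (degreeLT F (s.natDegree + 1) : Set F[X])).subset fun d hd ↦ ?_
  rw [SetLike.mem_coe, mem_degreeLT]
  exact degree_le_natDegree.trans_lt
    (by exact_mod_cast Nat.lt_succ_of_le (natDegree_le_of_dvd hd.2 hs))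

lemma numDiv_pos [Finite F] {s : F[X]} (hs : s ≠ 0) : 0 < numDiv s :=
  (Set.ncard_pos (finite_monic_divisors hs)).2 ⟨1, monic_one, one_dvd s⟩

lemma numDiv_lt_numDiv_mul [Finite F] {s t : F[X]} (hs : s.Monic) (ht : t.Monic)
    (ht0 : 0 < t.natDegree) : numDiv s < numDiv (s * t) := by
  refine Set.ncard_lt_ncard ⟨fun d hd ↦ ⟨hd.1, hd.2.mul_right t⟩, fun h ↦ ?_⟩
    (finite_monic_divisors (hs.mul ht).ne_zero)
  have := natDegree_le_of_dvd (h (show s * t ∈ _ from ⟨hs.mul ht, dvd_rfl⟩)).2 hs.ne_zero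
  rw [hs.natDegree_mul ht] at this
  omega

lemma numDiv_pow_mul {p u : F[X]} (hp : p.Monic) (hpi : Irreducible p) (hu : ¬p ∣ u) (a : ℕ) :
    numDiv (p ^ a * u) = (a + 1) * numDiv u := by
  have key : {d : F[X] | d.Monic ∧ d ∣ p ^ a * u} = (fun x : ℕ × F[X] ↦ p ^ x.1 * x.2) ''
      ((Finset.range (a + 1) : Set ℕ) ×ˢ {d : F[X] | d.Monic ∧ d ∣ u}) := by
    ext d
    constructor
    · rintro ⟨hd, hdvd⟩
      obtain ⟨e, f, he, hf, rfl⟩ := exists_dvd_and_dvd_of_dvd_mul hdvd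
      obtain ⟨i, hi, h⟩ := (dvd_prime_pow hpi.prime a).1 he
      obtain ⟨v, hv⟩ := h.symm
      rw [← hv, mul_assoc] at hd
      refine ⟨(i, v * f), ⟨by simpa [Nat.lt_succ_iff] using hi, (hp.pow i).of_mul_monic_left hd,
        v.isUnit.mul_left_dvd.2 hf⟩, ?_⟩
      simp only [← hv, mul_assoc]
    · rintro ⟨⟨i, f⟩, ⟨hi, hf, hfu⟩, rfl⟩
      simp only [Finset.coe_range, Set.mem_Iio] at hi
      exact ⟨(hp.pow i).mul hf, mul_dvd_mul (pow_dvd_pow p (by omega)) hfu⟩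
  have hinj : Set.InjOn (fun x : ℕ × F[X] ↦ p ^ x.1 * x.2)
      ((Finset.range (a + 1) : Set ℕ) ×ˢ {d : F[X] | d.Monic ∧ d ∣ u}) := by
    have aux : ∀ i j : ℕ, ∀ f g : F[X], ¬p ∣ g → p ^ i * f = p ^ j * g → i ≤ j := by
      intro i j f g hg h
      by_contra! hij
      obtain ⟨k, rfl⟩ := Nat.exists_eq_add_of_lt hij
      rw [pow_succ, pow_add, mul_assoc, mul_assoc] at h
      have := mul_left_cancel₀ (pow_ne_zero j hp.ne_zero) h
      exact hg ⟨p ^ k * f, by rw [← this]; ring⟩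
    rintro ⟨i, f⟩ ⟨-, -, hf⟩ ⟨j, g⟩ ⟨-, -, hg⟩ h
    have hf' : ¬p ∣ f := fun h ↦ hu (h.trans hf)
    have hg' : ¬p ∣ g := fun h ↦ hu (h.trans hg)
    obtain rfl : i = j := le_antisymm (aux _ _ _ _ hg' h) (aux _ _ _ _ hf' h.symm)
    exact Prod.ext rfl (mul_left_cancel₀ (pow_ne_zero i hp.ne_zero) h)
  rw [numDiv, key, hinj.ncard_image, Set.ncard_prod, Set.ncard_coe_finset,
    Finset.card_range, numDiv]

lemma exists_eq_pow_mul_not_dvd {p s : F[X]} (hp : p.Monic) (hpi : Irreducible p)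
    (hs : s.Monic) : ∃ a u, u.Monic ∧ ¬p ∣ u ∧ s = p ^ a * u := by
  obtain ⟨u, hu, hpu⟩ :=
    (FiniteMultiplicity.of_not_isUnit hpi.not_isUnit hs.ne_zero).exists_eq_pow_mul_and_not_dvd
  exact ⟨_, u, (hp.pow _).of_mul_monic_left (hu ▸ hs), hpu, hu⟩

lemma Polynomial.Monic.not_dvd_of_ne {p r : F[X]} (hp : p.Monic) (hr : r.Monic)
    (hpi : Irreducible p) (hri : Irreducible r) (h : r ≠ p) : ¬r ∣ p := fun hd ↦
  h (eq_of_monic_of_associated hr hp (hri.associated_of_dvd hpi hd))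

lemma IsMaximal.numDiv_lt [Finite F] {m : ℕ} {s t : F[X]} (hs : IsMaximal m s) (ht : t.Monic)
    (h : t.natDegree < m) : numDiv t < numDiv s :=
  (numDiv_lt_numDiv_mul ht monic_X (by simp)).trans_le
    (hs.2.2 _ (ht.mul monic_X) (by rw [ht.natDegree_mul monic_X, natDegree_X]; omega))

/-- In a maximal polynomial, an irreducible factor cannot be traded for a missing irreducible of
smaller degree. -/
lemma IsMaximal.natDegree_le_of_dvd_of_not_dvd [Finite F] {m : ℕ} {s p r : F[X]}
    (hs : IsMaximal m s) (hp : p.Monic) (hpi : Irreducible p) (hps : p ∣ s)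
    (hr : r.Monic) (hri : Irreducible r) (hrs : ¬r ∣ s) : p.natDegree ≤ r.natDegree := by
  obtain ⟨a, u, hu, hpu, rfl⟩ := exists_eq_pow_mul_not_dvd hp hpi hs.1
  by_contra! hlt
  have ha : 0 < a := Nat.pos_of_ne_zero fun h ↦ hpu (by simpa [h] using hps)
  have hru : ¬r ∣ u := fun h ↦ hrs (h.mul_left _)
  have hdeg := hs.2.1
  rw [(hp.pow a).natDegree_mul hu, hp.natDegree_pow] at hdeg
  have := hs.numDiv_lt ((hr.pow a).mul hu) (by
    rw [(hr.pow a).natDegree_mul hu, hr.natDegree_pow, ← hdeg]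
    have := Nat.mul_lt_mul_of_pos_left hlt ha
    omega)
  rw [numDiv_pow_mul hp hpi hpu, numDiv_pow_mul hr hri hru] at this
  exact lt_irrefl _ this

/-- Trading powers of an irreducible factor for a missing irreducible bounds exponents in a
maximal polynomial. -/
lemma IsMaximal.exponent_le [Finite F] {m a b : ℕ} {p r u : F[X]}
    (hs : IsMaximal m (p ^ a * u)) (hp : p.Monic) (hpi : Irreducible p) (hu : u.Monic)
    (hpu : ¬p ∣ u) (hr : r.Monic) (hri : Irreducible r) (hru : ¬r ∣ u) (hrp : r ≠ p)
    (hb : r.natDegree ≤ b * p.natDegree) : a + 1 ≤ 2 * b := by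
  by_contra! hab
  obtain ⟨c, rfl⟩ : ∃ c, a = c + b := ⟨a - b, by
    have : 0 < b := Nat.pos_of_ne_zero fun h ↦ by
      have := hri.natDegree_pos
      simp [h] at hb
      omega
    omega⟩
  have hdeg := hs.2.1
  rw [(hp.pow _).natDegree_mul hu, hp.natDegree_pow, add_mul] at hdeg
  have hr' : ¬r ∣ p ^ c * u := fun h ↦ (hri.prime.dvd_or_dvd h).elim
    (fun h ↦ hp.not_dvd_of_ne hr hpi hri hrp (hri.prime.dvd_of_dvd_pow h)) hru
  have h := hs.2.2 (r ^ 1 * (p ^ c * u)) ((hr.pow 1).mul ((hp.pow c).mul hu)) (by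
    rw [(hr.pow 1).natDegree_mul ((hp.pow c).mul hu), (hp.pow c).natDegree_mul hu,
      hp.natDegree_pow, hr.natDegree_pow]
    omega)
  rw [numDiv_pow_mul hr hri hr', numDiv_pow_mul hp hpi hpu, numDiv_pow_mul hp hpi hpu,
    ← mul_assoc] at h
  have := Nat.le_of_mul_le_mul_right h (numDiv_pos hu.ne_zero)
  omega

lemma natDegree_le_dt {s p : F[X]} (hs : s ≠ 0) (hp : p.Monic) (hpi : Irreducible p)
    (hps : p ∣ s) : p.natDegree ≤ dt s :=
  le_csSup ⟨s.natDegree, by rintro d ⟨r, -, -, hr, rfl⟩; exact natDegree_le_of_dvd hr hs⟩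
    ⟨p, hp, hpi, hps, rfl⟩

lemma exists_natDegree_eq_dt {s : F[X]} (hs : 0 < s.natDegree) :
    ∃ p : F[X], p.Monic ∧ Irreducible p ∧ p ∣ s ∧ p.natDegree = dt s := by
  have hs0 : s ≠ 0 := by rintro rfl; simp at hs
  refine Nat.sSup_mem (s := {d : ℕ | ∃ p : F[X], p.Monic ∧ Irreducible p ∧ p ∣ s ∧
    p.natDegree = d}) ?_
    ⟨s.natDegree, by rintro d ⟨r, -, -, hr, rfl⟩; exact natDegree_le_of_dvd hr hs0⟩
  obtain ⟨p, hp, hpi, hps⟩ := exists_monic_irreducible_factor s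
    (fun h ↦ hs.ne' (natDegree_eq_zero_of_isUnit h))
  exact ⟨_, p, hp, hpi, hps, rfl⟩

lemma dvd_of_squarefree_of_forall_irreducible {f s : F[X]} (hf : Squarefree f) (hf0 : f ≠ 0)
    (hs : s ≠ 0) (h : ∀ p : F[X], p.Monic → Irreducible p → p ∣ f → p ∣ s) : f ∣ s := by
  classical
  refine (hf.isRadical.dvd_radical hf0).trans
    ((radical_dvd_iff_primeFactors_subset hs).2 fun p hp ↦ ?_)
  rw [mem_primeFactors, mem_normalizedFactors_iff' hf0] at hp
  rw [mem_primeFactors, mem_normalizedFactors_iff' hs]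
  exact ⟨hp.1, hp.2.1, h p ((normalize_eq_self_iff_monic hp.1.ne_zero).1 hp.2.1) hp.1 hp.2.2⟩

end Field

section FiniteField

variable {F : Type} [Field F] [Fintype F]

lemma exists_monic_irreducible_natDegree_eq {n : ℕ} (hn : n ≠ 0) :
    ∃ p : F[X], p.Monic ∧ Irreducible p ∧ p.natDegree = n := by
  obtain ⟨c, _⟩ := CharP.exists F
  have : Fact c.Prime := ⟨CharP.char_is_prime F c⟩
  have : NeZero n := ⟨hn⟩
  obtain ⟨α, hα⟩ := Field.exists_primitive_element F (FiniteField.Extension F c n)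
  have hint : IsIntegral F α := .of_finite F α
  refine ⟨minpoly F α, minpoly.monic hint, minpoly.irreducible hint, ?_⟩
  rw [← IntermediateField.adjoin.finrank hint, hα, IntermediateField.finrank_top',
    FiniteField.finrank_extension]

lemma pow_card_le_natDegree_of_forall_dvd {s : F[X]} (hs : s ≠ 0) {n : ℕ} (hn : n ≠ 0)
    (h : ∀ p : F[X], p.Monic → Irreducible p → p.natDegree ≤ n → p ∣ s) :
    Fintype.card F ^ n ≤ s.natDegree := by
  have hq := Fintype.one_lt_card (α := F)
  obtain ⟨c, _⟩ := CharP.exists F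
  have hsep : (X ^ Fintype.card F ^ n - X : F[X]).Separable :=
    galois_poly_separable c _ (dvd_pow ((CharP.cast_eq_zero_iff F c _).1
      (Nat.cast_card_eq_zero F)) hn)
  have hne := FiniteField.X_pow_card_pow_sub_X_ne_zero F hn hq
  rw [← FiniteField.X_pow_card_pow_sub_X_natDegree_eq F hn hq]
  refine natDegree_le_of_dvd
    (dvd_of_squarefree_of_forall_irreducible hsep.squarefree hne hs fun p hp hpi hpd ↦ ?_) hs
  rw [Fintype.card_eq_nat_card, ← hpi.natDegree_dvd_iff_dvd_X_pow_card_pow_sub_X] at hpd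
  exact h p hp hpi (Nat.le_of_dvd (Nat.pos_of_ne_zero hn) hpd)

lemma card_mul_le_card_pow {n : ℕ} (hn : n ≠ 0) (S : Finset F[X])
    (hS : ∀ p ∈ S, p.Monic ∧ Irreducible p ∧ p.natDegree = n) :
    S.card * n ≤ Fintype.card F ^ n := by
  have hq := Fintype.one_lt_card (α := F)
  have hdvd : ∏ p ∈ S, p ∣ (X ^ Fintype.card F ^ n - X : F[X]) := by
    refine Finset.prod_dvd_of_coprime (fun p hp r hr hpr ↦ ?_) fun p hp ↦ ?_
    · obtain ⟨h1, h2, -⟩ := hS p hp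
      obtain ⟨h3, h4, -⟩ := hS r hr
      exact h2.coprime_iff_not_dvd.2 (h3.not_dvd_of_ne h1 h4 h2 hpr)
    · obtain ⟨-, h2, h3⟩ := hS p hp
      rw [Fintype.card_eq_nat_card, ← h2.natDegree_dvd_iff_dvd_X_pow_card_pow_sub_X, h3]
  have := natDegree_le_of_dvd hdvd (FiniteField.X_pow_card_pow_sub_X_ne_zero F hn hq)
  rwa [natDegree_prod_of_monic _ _ fun p hp ↦ (hS p hp).1,
    Finset.sum_congr rfl fun p hp ↦ (hS p hp).2.2, Finset.sum_const, smul_eq_mul,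
    FiniteField.X_pow_card_pow_sub_X_natDegree_eq F hn hq] at this

lemma IsMaximal.count_mul_natDegree_le [DecidableEq F] [DecidableEq F[X]] {m : ℕ} {s p : F[X]}
    (hs : IsMaximal m s) (hp : p.Monic) (hpi : Irreducible p) (hps : p ∣ s) :
    (normalizedFactors s).count p * p.natDegree ≤ 2 * dt s + p.natDegree := by
  obtain ⟨r, hr, hri, hrd⟩ :=
    exists_monic_irreducible_natDegree_eq (F := F) (Nat.succ_ne_zero (dt s))
  have hrs : ¬r ∣ s := fun h ↦ by
    have := natDegree_le_dt hs.1.ne_zero hr hri h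
    omega
  have hrp : r ≠ p := by rintro rfl; exact hrs hps
  obtain ⟨a, u, hu, hpu, hsu⟩ := exists_eq_pow_mul_not_dvd hp hpi hs.1
  have hcount : (normalizedFactors s).count p = a := by
    refine count_normalizedFactors_eq hpi hp.normalize_eq_self ⟨u, hsu⟩ fun h ↦ hpu ?_
    rwa [hsu, pow_succ, mul_dvd_mul_iff_left (pow_ne_zero a hp.ne_zero)] at h
  rw [hcount]
  have hk := hpi.natDegree_pos
  set k := p.natDegree
  have hdiv := Nat.div_add_mod (dt s) k
  have hmod := Nat.mod_lt (dt s) hk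
  have hexp := IsMaximal.exponent_le (b := dt s / k + 1) (hsu ▸ hs) hp hpi hu hpu hr hri
    (fun h ↦ hrs (hsu ▸ h.mul_left _)) hrp (by rw [hrd]; nlinarith)
  have hmul := Nat.mul_le_mul_right k hexp
  have hle := Nat.div_mul_le_self (dt s) k
  linarith

end FiniteField

lemma sum_pow_div_le {q : ℝ} (hq : 2 ≤ q) {n : ℕ} (hn : 0 < n) :
    ∑ k ∈ Finset.Icc 1 n, q ^ k / k ≤ 3 * q ^ n / n := by
  rcases Nat.lt_or_ge n 3 with h | h
  · interval_cases n
    · norm_num; linarith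
    · norm_num [Finset.sum_Icc_succ_top]; nlinarith
  · induction n, h using Nat.le_induction with
    | base =>
      norm_num [Finset.sum_Icc_succ_top]
      nlinarith [mul_nonneg (sub_nonneg.2 hq) (sub_nonneg.2 hq), sq_nonneg q]
    | succ n h ih =>
      have hn3 : (3 : ℝ) ≤ n := by exact_mod_cast h
      have ih := ih (by omega)
      rw [Finset.sum_Icc_succ_top (by omega)]
      have hpos : 0 < q ^ n := by positivity
      have key : 3 * q ^ n / n ≤ 2 * q ^ (n + 1) / ((n + 1 : ℕ) : ℝ) := by
        rw [div_le_div_iff₀ (by positivity) (by positivity), pow_succ]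
        push_cast
        nlinarith [mul_nonneg hpos.le (show (0 : ℝ) ≤ 2 * q * n - 3 * (n + 1) by nlinarith)]
      calc _ ≤ 2 * q ^ (n + 1) / ((n + 1 : ℕ) : ℝ) + q ^ (n + 1) / ((n + 1 : ℕ) : ℝ) := by
            gcongr; exact ih.trans key
        _ = _ := by ring

lemma sum_pow_lt {q : ℝ} (hq : 2 ≤ q) (n : ℕ) :
    ∑ k ∈ Finset.Icc 1 n, q ^ k < 2 * q ^ n := by
  induction n with
  | zero => simp
  | succ n ih =>
    rw [Finset.sum_Icc_succ_top (by omega), pow_succ]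
    nlinarith [show 0 < q ^ n by positivity]

lemma IsMaximal.lt_eight_mul {F : Type} [Field F] [Fintype F] {m : ℕ} (hm : 0 < m) {s : F[X]}
    (hs : IsMaximal m s) : m < 8 * Fintype.card F ^ dt s := by
  classical
  have hs0 := hs.1.ne_zero
  have hdt : 0 < dt s := by
    obtain ⟨p, -, hpi, -, h⟩ := exists_natDegree_eq_dt (s := s) (by rwa [hs.2.1])
    exact h ▸ hpi.natDegree_pos
  set S := (normalizedFactors s).toFinset with hS
  have hSp : ∀ p ∈ S, p.Monic ∧ Irreducible p ∧ p ∣ s := fun p hp ↦ by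
    rw [hS, Multiset.mem_toFinset, mem_normalizedFactors_iff' hs0] at hp
    exact ⟨(normalize_eq_self_iff_monic hp.1.ne_zero).1 hp.2.1, hp.1, hp.2.2⟩
  have hprod : s = ∏ p ∈ S, p ^ (normalizedFactors s).count p := by
    rw [← Finset.prod_multiset_count, prod_normalizedFactors_eq hs0, hs.1.normalize_eq_self]
  have hmaps : ∀ p ∈ S, p.natDegree ∈ Finset.Icc 1 (dt s) := fun p hp ↦ by
    obtain ⟨h1, h2, h3⟩ := hSp p hp
    exact Finset.mem_Icc.2 ⟨h2.natDegree_pos, natDegree_le_dt hs0 h1 h2 h3⟩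
  have hm1 : m ≤ ∑ k ∈ Finset.Icc 1 (dt s),
      (S.filter fun p ↦ p.natDegree = k).card * (2 * dt s + k) := by
    calc m = ∑ p ∈ S, (normalizedFactors s).count p * p.natDegree := by
          rw [← hs.2.1]
          conv_lhs => rw [hprod]
          rw [natDegree_prod_of_monic _ _ fun p hp ↦ (hSp p hp).1.pow _]
          exact Finset.sum_congr rfl fun p hp ↦ (hSp p hp).1.natDegree_pow _
      _ ≤ ∑ p ∈ S, (2 * dt s + p.natDegree) := Finset.sum_le_sum fun p hp ↦
          hs.count_mul_natDegree_le (hSp p hp).1 (hSp p hp).2.1 (hSp p hp).2.2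
      _ = _ := by
          rw [← Finset.sum_fiberwise_of_maps_to hmaps]
          refine Finset.sum_congr rfl fun k _ ↦ ?_
          rw [Finset.sum_congr rfl fun p hp ↦ by rw [(Finset.mem_filter.1 hp).2],
            Finset.sum_const, smul_eq_mul]
  have hq : (2 : ℝ) ≤ Fintype.card F := by exact_mod_cast Fintype.one_lt_card (α := F)
  have hdt' : (0 : ℝ) < dt s := by exact_mod_cast hdt
  set q : ℝ := (Fintype.card F : ℝ)
  have hm2 : (m : ℝ) ≤ ∑ k ∈ Finset.Icc 1 (dt s), (2 * dt s * (q ^ k / k) + q ^ k) := by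
    refine (Nat.cast_le.2 hm1).trans ?_
    push_cast
    refine Finset.sum_le_sum fun k hk ↦ ?_
    have hk1 := (Finset.mem_Icc.1 hk).1
    have hk0 : (0 : ℝ) < k := by exact_mod_cast hk1
    have hcard : ((S.filter fun p ↦ p.natDegree = k).card : ℝ) * k ≤ q ^ k := by
      have := card_mul_le_card_pow (n := k) (by omega) (S.filter fun p ↦ p.natDegree = k)
        fun p hp ↦ ⟨(hSp p (Finset.mem_filter.1 hp).1).1, (hSp p (Finset.mem_filter.1 hp).1).2.1,
          (Finset.mem_filter.1 hp).2⟩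
      simp only [q]
      exact_mod_cast this
    have hcard' := (le_div_iff₀ hk0).2 hcard
    nlinarith
  rw [Finset.sum_add_distrib, ← Finset.mul_sum] at hm2
  have h1 := mul_le_mul_of_nonneg_left (sum_pow_div_le hq hdt) (by positivity : 0 ≤ 2 * (dt s : ℝ))
  have h2 := sum_pow_lt hq (dt s)
  have h3 : 2 * (dt s : ℝ) * (3 * q ^ dt s / dt s) = 6 * q ^ dt s := by field_simp; ring
  refine (Nat.cast_lt (α := ℝ)).1 ?_
  push_cast
  linarith

/-- Proposition 3: if `s ∈ M_m` is maximal then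
`⌊log_q(m/8)⌋ < d_t(s) ≤ d_{t+1}(s) ≤ ⌊log_q m⌋ + 1`; in particular `m < 8·q^{d_t(s)}`
and `q^{d_{t+1}(s) - 1} ≤ m`. -/
theorem maximal_dt_bounds {F : Type} [Field F] [Fintype F]
    (m : ℕ) (hm : 0 < m) (s : F[X]) (hs : IsMaximal m s) :
    ⌊Real.logb (Fintype.card F) ((m : ℝ) / 8)⌋ < (dt s : ℤ) ∧
    dt s ≤ dt1 s ∧
    dt1 s ≤ ⌊Real.logb (Fintype.card F) (m : ℝ)⌋₊ + 1 ∧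
    m < 8 * Fintype.card F ^ dt s ∧
    Fintype.card F ^ (dt1 s - 1) ≤ m := by
  have hs0 := hs.1.ne_zero
  have hq' : (1 : ℝ) < Fintype.card F := by exact_mod_cast Fintype.one_lt_card (α := F)
  have hm' : (0 : ℝ) < m := by exact_mod_cast hm
  have hlow := hs.lt_eight_mul hm
  obtain ⟨p, hp, hpi, hps, hpd⟩ := exists_natDegree_eq_dt (s := s) (by rwa [hs.2.1])
  obtain ⟨-, r, hr, hri, hrd, hrs⟩ : dt1 s ∈ {d : ℕ | 0 < d ∧
      ∃ p : F[X], p.Monic ∧ Irreducible p ∧ p.natDegree = d ∧ ¬p ∣ s} := by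
    refine Nat.sInf_mem ?_
    obtain ⟨r, hr, hri, hrd⟩ :=
      exists_monic_irreducible_natDegree_eq (F := F) (Nat.succ_ne_zero (dt s))
    refine ⟨_, hri.natDegree_pos, r, hr, hri, rfl, fun h ↦ ?_⟩
    have := natDegree_le_dt hs0 hr hri h
    omega
  have hup : Fintype.card F ^ (dt1 s - 1) ≤ m := by
    rcases eq_or_ne (dt1 s - 1) 0 with h | h
    · rw [h, pow_zero]
      exact hm
    · rw [← hs.2.1]
      refine pow_card_le_natDegree_of_forall_dvd hs0 h fun t ht hti htd ↦ ?_
      by_contra hts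
      have : dt1 s ≤ t.natDegree := Nat.sInf_le ⟨hti.natDegree_pos, t, ht, hti, rfl, hts⟩
      omega
  refine ⟨?_, ?_, ?_, hlow, hup⟩
  · rw [Int.floor_lt, Real.logb_lt_iff_lt_rpow hq' (by positivity), Int.cast_natCast,
      Real.rpow_natCast, div_lt_iff₀ (by norm_num), mul_comm]
    exact_mod_cast hlow
  · rw [← hpd, ← hrd]
    exact hs.natDegree_le_of_dvd_of_not_dvd hp hpi hps hr hri hrs
  · rw [← Nat.sub_le_iff_le_add]
    refine Nat.le_floor ?_
    rw [Real.le_logb_iff_rpow_le hq' hm', Real.rpow_natCast]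
    exact_mod_cast hup
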